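/- H-theorem: Let f(q,p,t) > 0 be a classical solution of the Boltzmann equation ∂f/∂t = −(p/m)·∂f/∂q + (∂U/∂q)·(∂f/∂p) + St f, where St f is the Boltzmann collision integral with a collision transform preserving dp dp₁ dσ, which is an involution conserving |p−p₁|. Assume H(t) = ∫ f ln f dq dp is finite and differentiable, and boundary/decay conditions make the transport terms' contribution to dH/dt vanish. Then dH/dt ≤ 0. -/

import Mathlib

open MeasureTheory
open scoped RealInnerProductSpace

/-- If the fibre measures over a nonzero atomless measure on a standard Borel space are
almost everywhere measurable, then measures of sections are measurable over every uncountable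
standard Borel base. No finiteness of `σ` is needed. -/
lemma measurable_measure_section_of_aemeasurable_map_prodMk {X Y S : Type*}
    [MeasurableSpace X] [StandardBorelSpace X] [MeasurableSpace Y] [StandardBorelSpace Y]
    [MeasurableSpace S] (hY : ¬ Countable Y) {μ : Measure X} [NullSingletonClass μ] (hμ : μ ≠ 0)
    {σ : Measure S} (h : AEMeasurable (fun x : X => σ.map (Prod.mk x)) μ)
    {A : Set (Y × S)} (hA : MeasurableSet A) :
    Measurable (fun y => σ (Prod.mk y ⁻¹' A)) := by
  obtain ⟨g, hg, hfg⟩ := h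
  obtain ⟨N, hN, hNm, hN0⟩ := exists_measurable_superset_of_null (ae_iff.1 hfg)
  have hC : ¬ Countable (Nᶜ : Set X) := by
    intro hc
    have hNc : μ Nᶜ = 0 := (Set.countable_coe_iff.1 hc).measure_zero μ
    refine hμ (Measure.measure_univ_eq_zero.1 ?_)
    rw [← Set.union_compl_self N]
    exact measure_union_null hN0 hNc
  have : StandardBorelSpace (Nᶜ : Set X) := hNm.compl.standardBorel
  let e : Y ≃ᵐ (Nᶜ : Set X) := PolishSpace.measurableEquivOfNotCountable hY hC
  let ψ : Y → X := fun y => (e y : X)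
  have hψ : MeasurableEmbedding ψ :=
    (MeasurableEmbedding.subtype_coe hNm.compl).comp e.measurableEmbedding
  have hA' : MeasurableSet (Prod.map ψ (id : S → S) '' A) :=
    (hψ.prodMap MeasurableEmbedding.id).measurableSet_image' hA
  have hsection : ∀ y, σ (Prod.mk y ⁻¹' A) = g (ψ y) (Prod.map ψ id '' A) := by
    intro y
    have hy : σ.map (Prod.mk (ψ y)) = g (ψ y) := by
      by_contra hne
      exact (e y).2 (hN hne)
    rw [← hy, Measure.map_apply measurable_prodMk_left hA']
    congr 1
    ext s
    constructor
    · intro hs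
      exact ⟨(y, s), hs, rfl⟩
    · rintro ⟨⟨y', s'⟩, hmem, heq⟩
      obtain ⟨h₁, h₂⟩ := Prod.mk.inj heq
      have h₃ : y' = y := hψ.injective h₁
      have h₄ : s' = s := h₂
      subst h₃ h₄
      exact hmem
  simp_rw [hsection]
  exact (Measure.measurable_coe hA').comp (hg.comp hψ.measurable)

/-- Exchange of the first two factors of a triple product. -/
def prodSwapLeft (X S : Type*) [MeasurableSpace X] [MeasurableSpace S] :
    X × X × S ≃ᵐ X × X × S where
  toFun z := (z.2.1, z.1, z.2.2)
  invFun z := (z.2.1, z.1, z.2.2)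
  left_inv _ := rfl
  right_inv _ := rfl
  measurable_toFun := by dsimp; fun_prop
  measurable_invFun := by dsimp; fun_prop

/-- Exchanging the two atomless factors preserves `μ × μ × σ`, even if `σ` is not s-finite. -/
lemma measurePreserving_prodSwapLeft {X S : Type*} [MeasurableSpace X] [StandardBorelSpace X]
    [MeasurableSpace S] (μ : Measure X) [SFinite μ] [NullSingletonClass μ] (σ : Measure S) :
    MeasurePreserving (prodSwapLeft X S) (μ.prod (μ.prod σ)) (μ.prod (μ.prod σ)) := by
  refine ⟨(prodSwapLeft X S).measurable, ?_⟩
  rcases eq_or_ne μ 0 with rfl | hμ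
  · simp
  by_cases h : AEMeasurable (fun x : X => σ.map (Prod.mk x)) μ
  · have hX : ¬ Countable (X × X) := by
      intro hc
      have : Nonempty X := by
        by_contra hX
        rw [not_nonempty_iff] at hX
        exact hμ (Measure.eq_zero_of_isEmpty μ)
      have hX : Countable X := (Prod.fst_surjective (α := X) (β := X)).countable
      exact hμ (Measure.measure_univ_eq_zero.1 (Set.countable_univ.measure_zero μ))
    have hprod : ∀ {B : Set (X × S)}, MeasurableSet B →
        μ.prod σ B = ∫⁻ x, σ (Prod.mk x ⁻¹' B) ∂μ := by
      intro B hB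
      rw [Measure.prod, Measure.bind_apply hB h]
      exact lintegral_congr fun x => Measure.map_apply measurable_prodMk_left hB
    have hsec : ∀ {A : Set (X × X × S)}, MeasurableSet A →
        Measurable (fun w : X × X => σ {s | (w.1, w.2, s) ∈ A}) := by
      intro A hA
      exact measurable_measure_section_of_aemeasurable_map_prodMk hX hμ h
        (MeasurableEquiv.prodAssoc.measurable hA)
    have hsection : ∀ {A : Set (X × X × S)}, MeasurableSet A → ∀ y,
        (μ.prod σ).map (Prod.mk y) A = ∫⁻ x, σ {s | (y, x, s) ∈ A} ∂μ := by
      intro A hA y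
      rw [Measure.map_apply measurable_prodMk_left hA, hprod (measurable_prodMk_left hA)]
      rfl
    have hfibre : Measurable (fun y : X => (μ.prod σ).map (Prod.mk y)) := by
      refine Measure.measurable_of_measurable_coe _ fun A hA => ?_
      simp_rw [hsection hA]
      exact (hsec hA).lintegral_prod_right'
    have htriple : ∀ {A : Set (X × X × S)}, MeasurableSet A →
        μ.prod (μ.prod σ) A = ∫⁻ y, ∫⁻ x, σ {s | (y, x, s) ∈ A} ∂μ ∂μ := by
      intro A hA
      rw [Measure.prod, Measure.bind_apply hA hfibre.aemeasurable]
      exact lintegral_congr fun y => hsection hA y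
    ext A hA
    rw [Measure.map_apply (prodSwapLeft X S).measurable hA, htriple hA,
      htriple ((prodSwapLeft X S).measurable hA)]
    exact lintegral_lintegral_swap
      (f := fun y x => σ {s | (x, y, s) ∈ A}) ((hsec hA).comp measurable_swap).aemeasurable
  · have hzero : μ.prod σ = 0 := by
      rw [Measure.prod, Measure.bind, Measure.map_of_not_aemeasurable h, Measure.join_zero]
    rw [hzero]
    simp

/-- The entropy production inequality `(b - a) (log a - log b) ≤ 0`. -/
lemma sub_mul_log_sub_log_nonpos {a b : ℝ} (ha : 0 < a) (hb : 0 < b) :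
    (b - a) * (Real.log a - Real.log b) ≤ 0 := by
  rcases le_total a b with h | h
  · exact mul_nonpos_of_nonneg_of_nonpos (sub_nonneg.2 h)
      (sub_nonpos.2 (Real.log_le_log ha h))
  · exact mul_nonpos_of_nonpos_of_nonneg (sub_nonpos.2 h)
      (sub_nonneg.2 (Real.log_le_log hb h))

/-- The entropy production of a collision kernel which is symmetric under particle exchange and
under an involutive measure-preserving collision transform is nonpositive. -/
lemma integral_collision_mul_log_nonpos {X S : Type*} [MeasurableSpace X] [StandardBorelSpace X]
    [MeasurableSpace S] {μ : Measure X} [SFinite μ] [NullSingletonClass μ] {σ : Measure S}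
    {T : X × X × S → X × X × S}
    (hT : MeasurePreserving T (μ.prod (μ.prod σ)) (μ.prod (μ.prod σ)))
    (hTinv : Function.Involutive T)
    (hTswap : ∀ z, T (z.2.1, z.1, z.2.2) = ((T z).2.1, (T z).1, (T z).2.2))
    {K : X → X → ℝ} (hK : ∀ x y, 0 ≤ K x y) (hKsymm : ∀ x y, K x y = K y x)
    (hKT : ∀ z, K (T z).1 (T z).2.1 = K z.1 z.2.1)
    {f : X → ℝ} (hf : ∀ x, 0 < f x)
    (h₁ : Integrable (fun z : X × X × S => K z.1 z.2.1 *
      (f (T z).1 * f (T z).2.1 - f z.1 * f z.2.1) * (1 + Real.log (f z.1)))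
      (μ.prod (μ.prod σ)))
    (h₂ : Integrable (fun z : X × X × S => K z.1 z.2.1 *
      (f (T z).1 * f (T z).2.1 - f z.1 * f z.2.1) * (1 + Real.log (f z.2.1)))
      (μ.prod (μ.prod σ))) :
    ∫ z : X × X × S, K z.1 z.2.1 * (f (T z).1 * f (T z).2.1 - f z.1 * f z.2.1) *
      (1 + Real.log (f z.1)) ∂(μ.prod (μ.prod σ)) ≤ 0 := by
  set ν := μ.prod (μ.prod σ)
  set φ₁ : X × X × S → ℝ := fun z => K z.1 z.2.1 *
    (f (T z).1 * f (T z).2.1 - f z.1 * f z.2.1) * (1 + Real.log (f z.1)) with hφ₁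
  set φ₂ : X × X × S → ℝ := fun z => K z.1 z.2.1 *
    (f (T z).1 * f (T z).2.1 - f z.1 * f z.2.1) * (1 + Real.log (f z.2.1)) with hφ₂
  have hswap : ∫ z, φ₂ z ∂ν = ∫ z, φ₁ z ∂ν := by
    rw [← (measurePreserving_prodSwapLeft μ σ).integral_comp
      (prodSwapLeft X S).measurableEmbedding φ₁]
    refine integral_congr_ae (Filter.Eventually.of_forall fun z => ?_)
    change φ₂ z = φ₁ (z.2.1, z.1, z.2.2)
    simp only [hφ₁, hφ₂, hTswap, hKsymm z.2.1 z.1]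
    ring
  have hTemb : MeasurableEmbedding T :=
    (MeasurableEquiv.ofInvolutive T hTinv hT.measurable).measurableEmbedding
  have hsum : Integrable (fun z => φ₁ z + φ₂ z) ν := h₁.add h₂
  have hsumT : Integrable (fun z => φ₁ (T z) + φ₂ (T z)) ν :=
    (hT.integrable_comp_emb hTemb).2 hsum
  have hintT : ∫ z, (φ₁ (T z) + φ₂ (T z)) ∂ν = ∫ z, (φ₁ z + φ₂ z) ∂ν :=
    hT.integral_comp hTemb (fun z => φ₁ z + φ₂ z)
  have hle : ∫ z, ((φ₁ z + φ₂ z) + (φ₁ (T z) + φ₂ (T z))) ∂ν ≤ 0 := by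
    refine integral_nonpos fun z => ?_
    have hlog := sub_mul_log_sub_log_nonpos (mul_pos (hf z.1) (hf z.2.1))
      (mul_pos (hf (T z).1) (hf (T z).2.1))
    have hprod := mul_nonpos_of_nonneg_of_nonpos (hK z.1 z.2.1) hlog
    rw [Real.log_mul (hf _).ne' (hf _).ne', Real.log_mul (hf _).ne' (hf _).ne'] at hprod
    simp only [hφ₁, hφ₂, hTinv z, hKT, Pi.zero_apply]
    linarith
  rw [integral_add hsum hsumT, hintT, integral_add h₁ h₂, hswap] at hle
  linarith

/-- H-theorem: let `f(q,p,t) > 0` solve the Boltzmann equation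
`∂f/∂t = −(p/m)·∂f/∂q + (∂U/∂q)·(∂f/∂p) + St f` with a measure-preserving
involutive collision transform conserving the relative speed, and suppose
`H(t) = ∫ f ln f dq dp` is differentiable with derivative given by the collision
contribution (the transport terms' contribution vanishing by the boundary/decay
conditions). Then `dH/dt ≤ 0`. -/
theorem stmt_13 {S : Type*} [MeasureSpace S]
    (n m : ℝ) (hn : 0 < n) (hm : 0 < m)
    (G : Set (EuclideanSpace ℝ (Fin 3))) (hG : MeasurableSet G)
    (U : EuclideanSpace ℝ (Fin 3) → ℝ) (hU : ContDiff ℝ 1 U)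
    (T : EuclideanSpace ℝ (Fin 3) × EuclideanSpace ℝ (Fin 3) × S →
         EuclideanSpace ℝ (Fin 3) × EuclideanSpace ℝ (Fin 3) × S)
    (hT : MeasurePreserving T volume volume)
    (hTinv : T ∘ T = id)
    (hTspeed : ∀ z, ‖(T z).1 - (T z).2.1‖ = ‖z.1 - z.2.1‖)
    (hTswap : ∀ z, T (z.2.1, z.1, z.2.2) = ((T z).2.1, (T z).1, (T z).2.2))
    (f : ℝ → EuclideanSpace ℝ (Fin 3) → EuclideanSpace ℝ (Fin 3) → ℝ)
    (hfpos : ∀ t q p, 0 < f t q p)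
    (hfsmooth : ContDiff ℝ 1 (fun z : ℝ × EuclideanSpace ℝ (Fin 3) × EuclideanSpace ℝ (Fin 3) =>
      f z.1 z.2.1 z.2.2))
    -- the Boltzmann equation
    (hBoltzmann : ∀ t q p, HasDerivAt (fun s => f s q p)
      (-(1 / m) * ⟪p, gradient (fun v => f t v p) q⟫
        + ⟪gradient U q, gradient (fun v => f t q v) p⟫
        + n * ∫ y : EuclideanSpace ℝ (Fin 3) × S,
            (‖p - y.1‖ / m) *
              (f t q (T (p, y.1, y.2)).1 * f t q (T (p, y.1, y.2)).2.1
                - f t q p * f t q y.1)) t)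
    -- `H(t) = ∫∫ f ln f` and its derivative: differentiation under the integral
    -- is valid and the transport terms' contribution to `dH/dt` vanishes
    (H : ℝ → ℝ)
    (hH : ∀ t, H t = ∫ q in G, ∫ p : EuclideanSpace ℝ (Fin 3),
      f t q p * Real.log (f t q p))
    (hH' : ∀ t, HasDerivAt H
      (∫ q in G, ∫ z : EuclideanSpace ℝ (Fin 3) × EuclideanSpace ℝ (Fin 3) × S,
        (n * ‖z.1 - z.2.1‖ / m) *
          (f t q (T z).1 * f t q (T z).2.1 - f t q z.1 * f t q z.2.1) *
          (1 + Real.log (f t q z.1))) t)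
    -- absolute convergence of the symmetrized collision integrals
    (hInt1 : ∀ t q, Integrable
      (fun z : EuclideanSpace ℝ (Fin 3) × EuclideanSpace ℝ (Fin 3) × S =>
        (n * ‖z.1 - z.2.1‖ / m) *
          (f t q (T z).1 * f t q (T z).2.1 - f t q z.1 * f t q z.2.1) *
          (1 + Real.log (f t q z.1))))
    (hInt2 : ∀ t q, Integrable
      (fun z : EuclideanSpace ℝ (Fin 3) × EuclideanSpace ℝ (Fin 3) × S =>
        (n * ‖z.1 - z.2.1‖ / m) *
          (f t q (T z).1 * f t q (T z).2.1 - f t q z.1 * f t q z.2.1) *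
          (1 + Real.log (f t q z.2.1)))) :
    ∀ t, deriv H t ≤ 0 := by
  intro t
  rw [(hH' t).deriv]
  refine integral_nonpos fun q => ?_
  exact integral_collision_mul_log_nonpos (K := fun x y => n * ‖x - y‖ / m) hT
    (fun z => congrFun hTinv z) hTswap (fun x y => by positivity)
    (fun x y => by rw [norm_sub_rev]) (fun z => by rw [hTspeed]) (hfpos t q)
    (hInt1 t q) (hInt2 t q)
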